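/- arXiv:2202.11894 — 2 statements merged into one kernel-verified Lean document; each statement's English description precedes it below -/
import Mathlib

section
/- Let (g,⟨·,·⟩) be a unimodular metric Lie algebra and let X ∈ g be a stable stationary point of the Euler equation. Then every complex root of the characteristic polynomial of J_X is purely imaginary (has real part zero). -/
open scoped InnerProductSpace

/-- A Lie algebra structure (a bilinear Lie bracket) on the real inner product space `g`,
making `(g, ⟨·,·⟩)` a metric Lie algebra. -/
structure LieStructure (g : Type*) [NormedAddCommGroup g] [InnerProductSpace ℝ g] where
  bracket : g →ₗ[ℝ] g →ₗ[ℝ] g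
  bracket_self : ∀ x, bracket x x = 0
  jacobi : ∀ x y z, bracket x (bracket y z) + bracket y (bracket z x) + bracket z (bracket x y) = 0

namespace LieStructure

variable {g : Type*} [NormedAddCommGroup g] [InnerProductSpace ℝ g] [FiniteDimensional ℝ g]
variable (L : LieStructure g)

/-- `ad_Y : Z ↦ [Y, Z]`. -/
def ad (Y : g) : g →ₗ[ℝ] g := L.bracket Y

/-- `ad_Yᵗ`, the adjoint of `ad_Y` with respect to the inner product. -/
noncomputable def adT (Y : g) : g →ₗ[ℝ] g := LinearMap.adjoint (L.ad Y)

/-- A solution of the Euler equation `Ẏ = ad_Yᵗ Y`. -/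
def IsSolution (Y : ℝ → g) : Prop := ∀ t : ℝ, HasDerivAt Y (L.adT (Y t) (Y t)) t

/-- A stationary point (equilibrium) of the Euler equation: `ad_Xᵗ X = 0`. -/
def IsStationary (X : g) : Prop := L.adT X X = 0

/-- Lyapunov stability of a point `X` for the Euler equation: every solution starting
close to `X` remains close to `X` for all `t ≥ 0`. -/
def IsStable (X : g) : Prop :=
  ∀ ε > 0, ∃ δ > 0, ∀ Y : ℝ → g, L.IsSolution Y → ‖Y 0 - X‖ < δ → ∀ t ≥ 0, ‖Y t - X‖ < ε

/-- The linearisation `J_X : Y ↦ ad_Xᵗ Y + ad_Yᵗ X` of the Euler equation at `X`. -/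
noncomputable def J (X : g) : g →ₗ[ℝ] g where
  toFun Y := L.adT X Y + L.adT Y X
  map_add' Y Z := by
    simp only [adT, ad, map_add, LinearMap.add_apply]
    abel
  map_smul' c Y := by
    simp only [adT, ad, map_smul, map_smulₛₗ, starRingEnd_apply, star_trivial,
      LinearMap.smul_apply, RingHom.id_apply, smul_add]

/-- `g` is unimodular: `Tr (ad_X) = 0` for all `X`. -/
def IsUnimodular : Prop := ∀ X : g, LinearMap.trace ℝ g (L.ad X) = 0

/-- The centre of `g`: the set of `X` with `[X, ·] = 0`. -/
def center : Submodule ℝ g := LinearMap.ker L.bracket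

end LieStructure

/-- `σ_k(J)`: the `k`-th elementary symmetric function of the eigenvalues of `J`, i.e.
`(-1)^k` times the coefficient of `λ^(n-k)` in the characteristic polynomial
`det (λ·id - J)` of `J`, where `n = dim g`. -/
noncomputable def sigmaCoeff {g : Type*} [NormedAddCommGroup g] [InnerProductSpace ℝ g]
    [FiniteDimensional ℝ g] (k : ℕ) (J : g →ₗ[ℝ] g) : ℝ :=
  (-1 : ℝ) ^ k * (LinearMap.charpoly J).coeff (Module.finrank ℝ g - k)

open Set in
/-- A bounded, globally Lipschitz vector field on a Banach space is complete. -/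
theorem exists_global_integralCurve_of_lipschitzWith {E : Type*} [NormedAddCommGroup E]
    [NormedSpace ℝ E] [CompleteSpace E] {v : E → E} {K M : NNReal} (hv : LipschitzWith K v)
    (hM : ∀ x, ‖v x‖ ≤ M) (x : E) :
    ∃ γ : ℝ → E, γ 0 = x ∧ ∀ t, HasDerivAt γ (v (γ t)) t := by
  have key : ∀ a : ℝ, 0 < a → ∃ γ : ℝ → E, γ 0 = x ∧
      ∀ t ∈ Ioo (-a) a, HasDerivAt γ (v (γ t)) t := by
    intro a ha
    have hPL : IsPicardLindelof (fun _ => v) (tmin := -a) (tmax := a) ⟨0, by simp [ha.le]⟩ x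
        (M * a.toNNReal) 0 M K :=
      { lipschitzOnWith := fun _ _ => hv.lipschitzOnWith
        continuousOn := fun _ _ => continuousOn_const
        norm_le := fun _ _ y _ => hM y
        mul_max_le := by simp [ha.le] }
    obtain ⟨γ, h0, hγ⟩ := hPL.exists_eq_forall_mem_Icc_hasDerivWithinAt₀
    exact ⟨γ, h0, fun t ht =>
      (hγ t (Ioo_subset_Icc_self ht)).hasDerivAt (Icc_mem_nhds ht.1 ht.2)⟩
  choose! γ h0 hγ using key
  have agree : ∀ a b t : ℝ, 0 < a → a ≤ b → t ∈ Ioo (-a) a → γ a t = γ b t := by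
    intro a b t ha hab ht
    refine ODE_solution_unique_of_mem_Ioo (v := fun _ => v) (s := fun _ => univ) (K := K)
      (t₀ := 0) (fun _ _ => hv.lipschitzOnWith) ⟨by linarith, ha⟩
      (fun s hs => ⟨hγ a ha s hs, mem_univ _⟩)
      (fun s hs => ⟨hγ b (by linarith) s ⟨by linarith [hs.1], by linarith [hs.2]⟩, mem_univ _⟩)
      ?_ ht
    rw [h0 a ha, h0 b (by linarith)]
  refine ⟨fun t => γ (|t| + 1) t, h0 _ (by positivity), fun t => ?_⟩
  have hmem : ∀ s : ℝ, s ∈ Ioo (-(|s| + 1)) (|s| + 1) := fun s =>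
    ⟨by linarith [neg_abs_le s], by linarith [le_abs_self s]⟩
  have hd := hγ (|t| + 2) (by positivity) t
    ⟨by linarith [neg_abs_le t], by linarith [le_abs_self t]⟩
  have hev : (fun s => γ (|s| + 1) s) =ᶠ[nhds t] γ (|t| + 2) := by
    filter_upwards [continuous_abs.continuousAt.eventually_lt continuousAt_const
      (show |t| < |t| + 1 by linarith)] with s hs
    exact agree _ _ s (by positivity) (by linarith) (hmem s)
  have := hd.congr_of_eventuallyEq hev
  rwa [← hev.eq_of_nhds] at this

section QuadraticField

variable {E : Type*} [NormedAddCommGroup E] [InnerProductSpace ℝ E]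

/-- Along a curve whose velocity is orthogonal to its position the norm is constant. -/
theorem norm_eq_of_inner_deriv_eq_zero {γ w : ℝ → E} (hγ : ∀ t, HasDerivAt γ (w t) t)
    (h : ∀ t, ⟪w t, γ t⟫_ℝ = 0) (t : ℝ) : ‖γ t‖ = ‖γ 0‖ := by
  have hd : ∀ t, HasDerivAt (fun t => ‖γ t‖ ^ 2) 0 t := by
    intro t
    have := (hγ t).norm_sq
    rwa [real_inner_comm, h t, mul_zero] at this
  have := is_const_of_deriv_eq_zero (fun t => (hd t).differentiableAt) (fun t => (hd t).deriv) t 0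
  exact (sq_eq_sq₀ (norm_nonneg _) (norm_nonneg _)).1 this

variable [FiniteDimensional ℝ E]

/-- A quadratic vector field tangent to all spheres about the origin is complete. -/
theorem exists_global_solution_of_inner_self_eq_zero (B : E →L[ℝ] E →L[ℝ] E)
    (hB : ∀ y, ⟪B y y, y⟫_ℝ = 0) (x : E) :
    ∃ γ : ℝ → E, γ 0 = x ∧ ∀ t, HasDerivAt γ (B (γ t) (γ t)) t := by
  let φ : ContDiffBump (0 : E) := ⟨‖x‖ + 1, ‖x‖ + 2, by positivity, by linarith⟩
  let v : E → E := fun y => φ y • B y y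
  have hsupp : HasCompactSupport v := φ.hasCompactSupport.smul_right
  have hsmooth : ContDiff ℝ 1 v :=
    φ.contDiff.smul (B.contDiff.clm_apply contDiff_id)
  obtain ⟨K, hK⟩ := hsmooth.lipschitzWith_of_hasCompactSupport hsupp one_ne_zero
  obtain ⟨M, hM⟩ := hsupp.exists_bound_of_continuous hsmooth.continuous
  obtain ⟨γ, h0, hγ⟩ := exists_global_integralCurve_of_lipschitzWith hK (M := M.toNNReal)
    (fun y => (hM y).trans (Real.le_coe_toNNReal M)) x
  have hnorm := norm_eq_of_inner_deriv_eq_zero hγ (fun t => by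
    simp [v, real_inner_smul_left, hB])
  refine ⟨γ, h0, fun t => ?_⟩
  have h1 : φ (γ t) = 1 := φ.one_of_mem_closedBall (by
    simp only [mem_closedBall_zero_iff, hnorm t, h0, φ]; linarith)
  have := hγ t
  simpa only [v, h1, one_smul] using this

/-- If `⟨Q·,·⟩` satisfies the shifted Lyapunov equation `QA + AᵗQ = 2cQ + 1` with `c > 0`, then
solutions of `ẏ = Ay + B(y, y)` on which `⟨Q·,·⟩` is initially positive leave a fixed
neighbourhood of the origin. -/
theorem exists_escape_radius (A Q : E →ₗ[ℝ] E) (B : E →L[ℝ] E →L[ℝ] E) {c : ℝ} (hc : 0 < c)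
    (hQ : ∀ y, ⟪Q (A y), y⟫_ℝ + ⟪Q y, A y⟫_ℝ = 2 * c * ⟪Q y, y⟫_ℝ + ‖y‖ ^ 2) :
    ∃ ε > 0, ∀ y : ℝ → E, (∀ t, HasDerivAt y (A (y t) + B (y t) (y t)) t) →
      0 < ⟪Q (y 0), y 0⟫_ℝ → ∃ t ≥ 0, ε ≤ ‖y t‖ := by
  let q : E →L[ℝ] E := LinearMap.toContinuousLinearMap Q
  have hq : ∀ y, Q y = q y := fun _ => rfl
  refine ⟨1 / (2 * ‖q‖ * ‖B‖ + 1), by positivity, fun y hy h0 => ?_⟩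
  by_contra! hlt
  set ε := 1 / (2 * ‖q‖ * ‖B‖ + 1) with hε
  have hε1 : 2 * ‖q‖ * ‖B‖ * ε ≤ 1 := by
    rw [hε, mul_one_div, div_le_one (by positivity)]; linarith
  have hBy : ∀ z : E, ‖B z z‖ ≤ ‖B‖ * ‖z‖ ^ 2 := fun z => by
    simpa [pow_two, mul_assoc] using B.le_opNorm₂ z z
  let W : ℝ → ℝ := fun t => ⟪Q (y t), y t⟫_ℝ
  let W' : ℝ → ℝ := fun t => ⟪Q (y t), A (y t) + B (y t) (y t)⟫_ℝ +
    ⟪Q (A (y t) + B (y t) (y t)), y t⟫_ℝ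
  have hW : ∀ t, HasDerivAt W (W' t) t := fun t =>
    (q.hasFDerivAt.comp_hasDerivAt t (hy t)).inner ℝ (hy t)
  have hW' : ∀ t ≥ 0, 2 * c * W t ≤ W' t := by
    intro t ht
    have h1 : |⟪Q (y t), B (y t) (y t)⟫_ℝ| ≤ ‖q‖ * ‖y t‖ * (‖B‖ * ‖y t‖ ^ 2) :=
      (abs_real_inner_le_norm _ _).trans
        (mul_le_mul (q.le_opNorm _) (hBy _) (norm_nonneg _) (by positivity))
    have h2 : |⟪Q (B (y t) (y t)), y t⟫_ℝ| ≤ ‖q‖ * (‖B‖ * ‖y t‖ ^ 2) * ‖y t‖ :=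
      (abs_real_inner_le_norm _ _).trans (mul_le_mul_of_nonneg_right
        ((q.le_opNorm _).trans (mul_le_mul_of_nonneg_left (hBy _) (norm_nonneg _)))
        (norm_nonneg _))
    have h3 : 2 * ‖q‖ * ‖B‖ * ‖y t‖ ≤ 1 :=
      (mul_le_mul_of_nonneg_left (hlt t ht).le (by positivity)).trans hε1
    have h4 := mul_le_mul_of_nonneg_right h3 (sq_nonneg ‖y t‖)
    have h5 := hQ (y t)
    simp only [W, W', map_add, inner_add_left, inner_add_right]
    linarith [neg_abs_le ⟪Q (y t), B (y t) (y t)⟫_ℝ, neg_abs_le ⟪Q (B (y t) (y t)), y t⟫_ℝ]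
  have hmono : MonotoneOn (fun t => Real.exp (-(2 * c * t)) * W t) (Set.Ici 0) := by
    have hd : ∀ t, HasDerivAt (fun t => Real.exp (-(2 * c * t)) * W t)
        (Real.exp (-(2 * c * t)) * (W' t - 2 * c * W t)) t := by
      intro t
      have he : HasDerivAt (fun t : ℝ => -(2 * c * t)) (-(2 * c)) t := by
        simpa using (hasDerivAt_id t).const_mul (-(2 * c))
      exact (he.exp.mul (hW t)).congr_deriv (by ring)
    refine monotoneOn_of_hasDerivWithinAt_nonneg (convex_Ici 0)
      (fun t _ => (hd t).continuousAt.continuousWithinAt)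
      (fun t _ => (hd t).hasDerivWithinAt) (fun t ht => ?_)
    rw [interior_Ici] at ht
    exact mul_nonneg (Real.exp_nonneg _) (sub_nonneg.2 (hW' t (le_of_lt ht)))
  have hgrow : ∀ t ≥ 0, (2 * c * t) * W 0 ≤ ‖q‖ * ε * ε := by
    intro t ht
    have h1 : W 0 ≤ Real.exp (-(2 * c * t)) * W t := by
      simpa using hmono Set.self_mem_Ici ht ht
    have h2 : Real.exp (2 * c * t) * W 0 ≤ W t := by
      have := mul_le_mul_of_nonneg_left h1 (Real.exp_nonneg (2 * c * t))
      rwa [← mul_assoc, ← Real.exp_add, add_neg_cancel, Real.exp_zero, one_mul] at this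
    have h3 : W t ≤ ‖q‖ * ε * ε :=
      (real_inner_le_norm _ _).trans (mul_le_mul
        ((q.le_opNorm _).trans (mul_le_mul_of_nonneg_left (hlt t ht).le (norm_nonneg _)))
        (hlt t ht).le (norm_nonneg _) (by positivity))
    have h4 : 2 * c * t ≤ Real.exp (2 * c * t) := by linarith [Real.add_one_le_exp (2 * c * t)]
    exact ((mul_le_mul_of_nonneg_right h4 (le_of_lt h0)).trans h2).trans h3
  have h0' : 0 < W 0 := h0
  have hpos : 0 < 2 * c * W 0 := by positivity
  have := hgrow ((‖q‖ * ε * ε + 1) / (2 * c * W 0)) (by positivity)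
  have heq : 2 * c * ((‖q‖ * ε * ε + 1) / (2 * c * W 0)) * W 0 = ‖q‖ * ε * ε + 1 := by
    field_simp
  linarith

/-- For all but finitely many shifts, hence for some `c` in any interval `(0, a)`, the Lyapunov
equation `QA + AᵗQ = 2cQ + 1` is solvable. -/
theorem exists_lyapunov_solution (A : E →ₗ[ℝ] E) {a : ℝ} (ha : 0 < a) :
    ∃ c, 0 < c ∧ c < a ∧ ∃ Q : E →ₗ[ℝ] E,
      ∀ y, ⟪Q (A y), y⟫_ℝ + ⟪Q y, A y⟫_ℝ = 2 * c * ⟪Q y, y⟫_ℝ + ‖y‖ ^ 2 := by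
  let S : Module.End ℝ (Module.End ℝ E) :=
    LinearMap.mulRight ℝ A + LinearMap.mulLeft ℝ (LinearMap.adjoint A)
  obtain ⟨μ, ⟨hμ0, hμa⟩, hμ⟩ :=
    (Set.Ioo_infinite (show (0 : ℝ) < 2 * a by linarith)).exists_notMem_finite S.finite_hasEigenvalue
  refine ⟨μ / 2, by linarith, by linarith, ?_⟩
  have hinj : Function.Injective (S - algebraMap ℝ (Module.End ℝ (Module.End ℝ E)) μ) := by
    rw [← LinearMap.ker_eq_bot]
    by_contra h
    exact hμ (Module.End.hasEigenvalue_iff.2 (by rwa [Module.End.eigenspace_def]))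
  obtain ⟨Q, hQ⟩ := LinearMap.surjective_of_injective hinj 1
  refine ⟨Q, fun y => ?_⟩
  have := congrArg (fun T : Module.End ℝ E => ⟪T y, y⟫_ℝ) hQ
  simp only [S, LinearMap.sub_apply, LinearMap.add_apply, LinearMap.mulRight_apply,
    LinearMap.mulLeft_apply, Module.algebraMap_end_apply, Module.End.mul_apply,
    Module.End.one_apply, LinearMap.smul_apply, inner_sub_left, inner_add_left,
    real_inner_smul_left, LinearMap.adjoint_inner_left, real_inner_self_eq_norm_sq] at this
  linarith

end QuadraticField

/-- A complex root of the characteristic polynomial of a real operator yields the real and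
imaginary parts of a complex eigenvector. -/
theorem LinearMap.exists_re_im_eigenvector {V : Type*} [AddCommGroup V] [Module ℝ V]
    [FiniteDimensional ℝ V] (A : V →ₗ[ℝ] V) {z : ℂ}
    (hz : (A.charpoly.map (algebraMap ℝ ℂ)).IsRoot z) :
    ∃ u w : V, (u ≠ 0 ∨ w ≠ 0) ∧ A u = z.re • u - z.im • w ∧ A w = z.im • u + z.re • w := by
  let b := Module.finBasis ℝ V
  let M := LinearMap.toMatrix b b A
  rw [← LinearMap.charpoly_toMatrix A b, ← Matrix.charpoly_map, Polynomial.IsRoot,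
    Matrix.eval_charpoly] at hz
  obtain ⟨v, hv0, hv⟩ := Matrix.exists_mulVec_eq_zero_iff.2 hz
  have hv' : ∀ i, ∑ j, (M i j : ℂ) * v j = z * v i := by
    intro i
    have := congrFun hv i
    simp only [Matrix.sub_mulVec, Matrix.scalar_apply, Pi.sub_apply, Matrix.mulVec_diagonal,
      Pi.zero_apply, sub_eq_zero] at this
    exact this.symm
  have hA : ∀ f : Fin (Module.finrank ℝ V) → ℝ,
      A (b.equivFun.symm f) = b.equivFun.symm (M.mulVec f) := by
    intro f
    apply b.equivFun.injective
    rw [LinearEquiv.apply_symm_apply]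
    have := LinearMap.toMatrix_mulVec_repr b b A (b.equivFun.symm f)
    rw [← Module.Basis.equivFun_apply, LinearEquiv.apply_symm_apply] at this
    exact this.symm
  refine ⟨b.equivFun.symm fun i => (v i).re, b.equivFun.symm fun i => (v i).im, ?_, ?_, ?_⟩
  · by_contra! h
    refine hv0 (funext fun i => Complex.ext ?_ ?_)
    · exact congrFun ((LinearEquiv.map_eq_zero_iff _).1 h.1) i
    · exact congrFun ((LinearEquiv.map_eq_zero_iff _).1 h.2) i
  · rw [hA, ← map_smul, ← map_smul, ← map_sub]
    congr 1
    ext i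
    simpa [Matrix.mulVec, dotProduct] using congrArg Complex.re (hv' i)
  · rw [hA, ← map_smul, ← map_smul, ← map_add]
    congr 1
    ext i
    simpa [Matrix.mulVec, dotProduct, add_comm] using congrArg Complex.im (hv' i)

/-- If a traceless real operator has no complex eigenvalue with positive real part, then all its
complex eigenvalues are purely imaginary. -/
theorem LinearMap.re_eq_zero_of_trace_eq_zero {V : Type*} [AddCommGroup V] [Module ℝ V]
    [FiniteDimensional ℝ V] (A : V →ₗ[ℝ] V) (htr : LinearMap.trace ℝ V A = 0)
    (hre : ∀ z : ℂ, (A.charpoly.map (algebraMap ℝ ℂ)).IsRoot z → z.re ≤ 0)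
    {z : ℂ} (hz : (A.charpoly.map (algebraMap ℝ ℂ)).IsRoot z) : z.re = 0 := by
  let b := Module.finBasis ℝ V
  let M := (LinearMap.toMatrix b b A).map (algebraMap ℝ ℂ)
  have hM : M.charpoly = A.charpoly.map (algebraMap ℝ ℂ) := by
    rw [← LinearMap.charpoly_toMatrix A b, ← Matrix.charpoly_map]
  have hne : A.charpoly.map (algebraMap ℝ ℂ) ≠ 0 := (A.charpoly_monic.map _).ne_zero
  have hsum : (M.charpoly.roots.map Complex.re).sum = 0 := by
    have h1 : M.trace = 0 := by
      rw [LinearMap.trace_eq_matrix_trace ℝ b] at htr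
      rw [← AddMonoidHom.map_trace (algebraMap ℝ ℂ), htr, map_zero]
    rw [Matrix.trace_eq_sum_roots_charpoly] at h1
    have := congrArg Complex.reAddGroupHom h1
    rwa [map_multiset_sum, map_zero] at this
  have hmem : z ∈ M.charpoly.roots := by
    rw [hM]
    exact (Polynomial.mem_roots hne).2 hz
  have hneg : (M.charpoly.roots.map fun w => -w.re).sum = 0 := by
    rw [Multiset.sum_map_neg, hsum, neg_zero]
  refine neg_eq_zero.1 (Multiset.all_zero_of_le_zero_le_of_sum_eq_zero ?_ hneg _
    (Multiset.mem_map_of_mem _ hmem))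
  simp only [Multiset.mem_map]
  rintro _ ⟨w, hw, rfl⟩
  rw [hM] at hw
  exact neg_nonneg.2 (hre w (Polynomial.isRoot_of_mem_roots hw))

namespace LieStructure

variable {g : Type*} [NormedAddCommGroup g] [InnerProductSpace ℝ g] [FiniteDimensional ℝ g]
variable (L : LieStructure g)

/-- The bilinear map `(Y, Z) ↦ ad_Yᵗ Z` as a continuous bilinear map. -/
noncomputable def adTBilin : g →L[ℝ] g →L[ℝ] g :=
  LinearMap.toContinuousBilinearMap (LinearMap.mk₂ ℝ (fun Y Z => L.adT Y Z)
    (fun _ _ _ => by simp [adT, ad]) (fun _ _ _ => by simp [adT, ad])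
    (fun _ _ _ => by simp) (fun _ _ _ => by simp))

@[simp] theorem adTBilin_apply (Y Z : g) : L.adTBilin Y Z = L.adT Y Z := rfl

theorem inner_adT_left (X Y Z : g) : ⟪L.adT X Y, Z⟫_ℝ = ⟪Y, L.bracket X Z⟫_ℝ :=
  LinearMap.adjoint_inner_left _ _ _

/-- Every point is the initial value of a global solution of the Euler equation. -/
theorem exists_isSolution (x : g) : ∃ Y : ℝ → g, L.IsSolution Y ∧ Y 0 = x := by
  obtain ⟨Y, h0, hY⟩ := exists_global_solution_of_inner_self_eq_zero L.adTBilin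
    (fun y => by simp [inner_adT_left, L.bracket_self]) x
  exact ⟨Y, hY, h0⟩

theorem trace_J (huni : L.IsUnimodular) (X : g) : LinearMap.trace ℝ g (L.J X) = 0 := by
  let b := stdOrthonormalBasis ℝ g
  have h1 := huni X
  rw [LinearMap.trace_eq_sum_inner _ b] at h1 ⊢
  rw [← h1]
  refine Finset.sum_congr rfl fun i _ => ?_
  have : L.J X (b i) = L.adT X (b i) + L.adT (b i) X := rfl
  rw [this, real_inner_comm, inner_add_left, inner_adT_left, inner_adT_left, L.bracket_self,
    inner_zero_right, add_zero]
  rfl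

theorem re_le_zero_of_isStable {X : g} (hX : L.IsStationary X) (hstable : L.IsStable X) {z : ℂ}
    (hz : ((L.J X).charpoly.map (algebraMap ℝ ℂ)).IsRoot z) : z.re ≤ 0 := by
  by_contra! hpos
  obtain ⟨c, hc, hcz, Q, hQ⟩ := exists_lyapunov_solution (L.J X) hpos
  obtain ⟨v, hv⟩ : ∃ v, 0 < ⟪Q v, v⟫_ℝ := by
    obtain ⟨u, w, hne, hu, hw⟩ := (L.J X).exists_re_im_eigenvector hz
    have h1 := hQ u
    have h2 := hQ w
    simp only [hu, hw, map_add, map_sub, map_smul, inner_add_left, inner_sub_left,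
      inner_add_right, inner_sub_right, real_inner_smul_left, real_inner_smul_right] at h1 h2
    have hsq : 0 < ‖u‖ ^ 2 + ‖w‖ ^ 2 := by
      rcases hne with h | h
      · have := norm_pos_iff.2 h
        positivity
      · have := norm_pos_iff.2 h
        positivity
    by_contra! hle
    nlinarith [hle u, hle w]
  obtain ⟨ε, hε, hesc⟩ := exists_escape_radius (L.J X) Q L.adTBilin hc hQ
  obtain ⟨δ, hδ, hst⟩ := hstable ε hε
  have hv0 : v ≠ 0 := by
    rintro rfl
    simp at hv
  have hvn : 0 < ‖v‖ := norm_pos_iff.2 hv0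
  set s : ℝ := δ / (2 * ‖v‖) with hs
  have hs0 : 0 < s := by positivity
  obtain ⟨Y, hY, hY0⟩ := L.exists_isSolution (X + s • v)
  have hclose : ‖Y 0 - X‖ < δ := by
    rw [hY0, add_sub_cancel_left, norm_smul, Real.norm_of_nonneg hs0.le, hs]
    field_simp
    linarith
  obtain ⟨t, ht, hle⟩ := hesc (fun t => Y t - X) (fun t => by
      have h := (hY t).sub_const X
      have hX' : L.adTBilin X X = 0 := hX
      convert h using 1
      have hJ : L.J X (Y t - X) = L.adTBilin X (Y t - X) + L.adTBilin (Y t - X) X := rfl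
      rw [hJ, ← adTBilin_apply]
      simp only [map_sub, sub_apply, hX']
      abel) (by
      simp only [hY0, add_sub_cancel_left, map_smul, real_inner_smul_left, real_inner_smul_right]
      positivity)
  exact absurd (hst Y hY hclose t ht) (not_lt.2 hle)

end LieStructure

/-- Lemma 2.1 (a), third part: in a unimodular metric Lie algebra, all eigenvalues of the
linearisation at a stable stationary point lie on the imaginary axis. -/
theorem eigenvalues_imaginary_of_stable    {g : Type*} [NormedAddCommGroup g] [InnerProductSpace ℝ g] [FiniteDimensional ℝ g]
    (L : LieStructure g) (huni : L.IsUnimodular)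
    (X : g) (hX : L.IsStationary X) (hstable : L.IsStable X) :
    ∀ z : ℂ, (Polynomial.map (algebraMap ℝ ℂ) (LinearMap.charpoly (L.J X))).IsRoot z →
      z.re = 0 := by
  intro z hz
  exact (L.J X).re_eq_zero_of_trace_eq_zero (L.trace_J huni X)
    (fun _ h => L.re_le_zero_of_isStable hX hstable h) hz
end

section
/- Let (g,⟨·,·⟩) be a metric Lie algebra and let X ∈ g. If J_X is skew-adjoint or ad_X is skew-adjoint (in particular, if J_X = 0 or if X lies in the centre of g), then X is a stationary point of the Euler equation and X is stable. -/
open scoped InnerProductSpace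

namespace LieStructure

section Skew

variable {g : Type*} [NormedAddCommGroup g] [InnerProductSpace ℝ g] (L : LieStructure g)

theorem bracket_skew (x y : g) : L.bracket x y = -L.bracket y x := by
  have h := L.bracket_self (x + y)
  simp only [map_add, LinearMap.add_apply, L.bracket_self, zero_add, add_zero] at h
  rw [add_comm] at h
  exact eq_neg_of_add_eq_zero_left h

variable [FiniteDimensional ℝ g]

theorem inner_adT (x y z : g) : ⟪L.adT x y, z⟫_ℝ = ⟪y, L.bracket x z⟫_ℝ :=
  LinearMap.adjoint_inner_left _ _ _

/-- The quadratic forms of `J_X` and `ad_X` agree, so if one of the operators is skew-adjoint,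
both forms vanish. -/
theorem inner_bracket_eq_zero_of_skew {X : g}
    (hskew : LinearMap.adjoint (L.J X) = -(L.J X) ∨ L.adT X = -(L.ad X)) (Y : g) :
    ⟪Y, L.bracket X Y⟫_ℝ = 0 := by
  rcases hskew with h | h
  · have hJ : ⟪L.J X Y, Y⟫_ℝ = ⟪Y, L.bracket X Y⟫_ℝ := by
      change ⟪L.adT X Y + L.adT Y X, Y⟫_ℝ = _
      rw [inner_add_left, inner_adT, inner_adT, L.bracket_self, inner_zero_right, add_zero]
    have h' := LinearMap.adjoint_inner_left (L.J X) Y Y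
    rw [h, LinearMap.neg_apply, inner_neg_left, real_inner_comm Y (L.J X Y)] at h'
    linarith [real_inner_comm Y (L.J X Y)]
  · have h' := L.inner_adT X Y Y
    rw [h, LinearMap.neg_apply, inner_neg_left] at h'
    change -⟪L.bracket X Y, Y⟫_ℝ = _ at h'
    linarith [real_inner_comm Y (L.bracket X Y)]

theorem isStationary_of_inner_bracket_eq_zero {X : g}
    (h : ∀ Y, ⟪Y, L.bracket X Y⟫_ℝ = 0) : L.IsStationary X := by
  refine ext_inner_right ℝ fun Z => ?_
  have h' := h (X + Z)
  simp only [map_add, inner_add_left, L.bracket_self, h Z,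
    zero_add, add_zero] at h'
  rw [inner_adT, h', inner_zero_left]

/-- If the quadratic form of `ad_X` vanishes, the distance to `X` is a first integral of the
Euler equation. -/
theorem norm_sub_eq_of_inner_bracket_eq_zero {X : g}
    (h : ∀ Y, ⟪Y, L.bracket X Y⟫_ℝ = 0) {Y : ℝ → g} (hY : L.IsSolution Y) (s t : ℝ) :
    ‖Y s - X‖ = ‖Y t - X‖ := by
  have hd : ∀ r, HasDerivAt (fun r => ‖Y r - X‖ ^ 2) 0 r := fun r => by
    have h0 : ⟪Y r - X, L.adT (Y r) (Y r)⟫_ℝ = 0 := by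
      rw [real_inner_comm, inner_adT, map_sub, L.bracket_self, zero_sub, ← L.bracket_skew, h]
    simpa only [h0, mul_zero] using ((hY r).sub_const X).norm_sq
  have hc := is_const_of_deriv_eq_zero (fun r => (hd r).differentiableAt)
    (fun r => (hd r).deriv) s t
  exact (sq_eq_sq₀ (norm_nonneg _) (norm_nonneg _)).1 hc

end Skew

end LieStructure

/-- Lemma 2.1 (b): if `J_X` or `ad_X` is skew-adjoint, then `X` is a stable stationary
point. -/
theorem stable_of_skew    {g : Type*} [NormedAddCommGroup g] [InnerProductSpace ℝ g] [FiniteDimensional ℝ g]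
    (L : LieStructure g) (X : g)
    (hskew : LinearMap.adjoint (L.J X) = -(L.J X) ∨ L.adT X = -(L.ad X)) :
    L.IsStationary X ∧ L.IsStable X := by
  have h := L.inner_bracket_eq_zero_of_skew hskew
  refine ⟨L.isStationary_of_inner_bracket_eq_zero h, fun ε hε => ⟨ε, hε, fun Y hY h0 t _ => ?_⟩⟩
  rwa [L.norm_sub_eq_of_inner_bracket_eq_zero h hY t 0]
end
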